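/- arXiv:math/0401391 — 2 statements merged into one kernel-verified Lean document; each statement's English description precedes it below -/
import Mathlib

section
/- Let T be a polynomial with real coefficients of degree d ≥ 1 and let x ∈ ℝ be such that the polynomial T − x has d distinct real roots λ₁, …, λ_d. Let M be the d × d real matrix with entries M_{ij} = 1/((λ_i − λ_j)·T'(λ_j)) for i ≠ j and M_{ii} = T''(λ_i)/(2·T'(λ_i)²). Then the trace of MᵀM equals −(1/3)·Σ_{k=1}^{d} S(T)(λ_k)/T'(λ_k)², where S(T) = T'''/T' − (3/2)·(T''/T')² is the Schwarzian derivative of T. -/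
open Polynomial Matrix

/-- The Schwarzian derivative of a real polynomial, `S(T) = T'''/T' - (3/2)(T''/T')²`,
evaluated at a point. -/
noncomputable def polySchwarzian (T : Polynomial ℝ) (y : ℝ) : ℝ :=
  (derivative (derivative (derivative T))).eval y / (derivative T).eval y -
    (3 / 2) * ((derivative (derivative T)).eval y / (derivative T).eval y) ^ 2

/-- The first two derivatives of `∏ k ∈ s, (X - C (a k))` at a point `y` outside the roots, in
terms of the power sums of the numbers `(y - a k)⁻¹`. -/
theorem eval_derivative_prod_X_sub_C {ι F : Type*} [Field F] [DecidableEq ι] (a : ι → F) (y : F)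
    (s : Finset ι) (h : ∀ k ∈ s, y - a k ≠ 0) :
    (derivative (∏ k ∈ s, (X - C (a k)))).eval y =
        (∏ k ∈ s, (X - C (a k))).eval y * ∑ k ∈ s, (y - a k)⁻¹ ∧
      (derivative (derivative (∏ k ∈ s, (X - C (a k))))).eval y =
        (∏ k ∈ s, (X - C (a k))).eval y *
          ((∑ k ∈ s, (y - a k)⁻¹) ^ 2 - ∑ k ∈ s, (y - a k)⁻¹ ^ 2) := by
  induction s using Finset.induction_on with
  | empty => simp
  | insert i s hi ih =>
    obtain ⟨ih₁, ih₂⟩ := ih fun k hk => h k (Finset.mem_insert_of_mem hk)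
    have hy := h i (Finset.mem_insert_self i s)
    rw [Finset.prod_insert hi, Finset.sum_insert hi, Finset.sum_insert hi]
    simp only [derivative_mul, derivative_sub, derivative_X, derivative_C, sub_zero, one_mul,
      derivative_add, eval_add, eval_mul, eval_sub, eval_X, eval_C, ih₁, ih₂]
    constructor
    · field_simp
    · field_simp
      ring

/-- If `T - x = c (X - b) ∏ k ∈ s, (X - a k)` with `b` a simple root, then the sum of the inverse
squared distances from `b` to the other roots is `(T'' / (2 T'))² - T''' / (3 T')` at `b`. -/
theorem sum_inv_sq_sub_root {ι : Type*} [DecidableEq ι] (T : Polynomial ℝ) (x c b : ℝ) (hc : c ≠ 0)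
    (a : ι → ℝ) (s : Finset ι) (h : ∀ k ∈ s, b - a k ≠ 0)
    (hT : T - C x = C c * ((X - C b) * ∏ k ∈ s, (X - C (a k)))) :
    (derivative T).eval b ≠ 0 ∧
      ∑ k ∈ s, (b - a k)⁻¹ ^ 2 =
        ((derivative (derivative T)).eval b / (2 * (derivative T).eval b)) ^ 2 -
          (derivative (derivative (derivative T))).eval b / (3 * (derivative T).eval b) := by
  obtain ⟨h₁, h₂⟩ := eval_derivative_prod_X_sub_C a b s h
  have hne : (∏ k ∈ s, (X - C (a k))).eval b ≠ 0 := by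
    simpa [eval_prod, Finset.prod_ne_zero_iff] using h
  rw [sub_eq_iff_eq_add] at hT
  subst hT
  simp only [derivative_mul, derivative_sub, derivative_X, derivative_C, sub_zero, one_mul,
    zero_mul, zero_add, add_zero, derivative_add, eval_add, eval_mul, eval_sub, eval_X, eval_C,
    sub_self, h₁, h₂]
  refine ⟨mul_ne_zero hc hne, ?_⟩
  field_simp
  ring

/-- If `T - x` has `d` distinct real roots and `M` is the matrix of the operator `FD`
in the eigenbasis of `J`, then `tr(MᵀM) = -(1/3) ∑ₖ S(T)(Λ k)/T'(Λ k)²`. -/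
theorem trace_FD_transpose_mul_FD
    (d : ℕ) (hd : 1 ≤ d) (T : Polynomial ℝ) (hdeg : T.natDegree = d)
    (x : ℝ) (Λ : Fin d → ℝ) (hinj : Function.Injective Λ)
    (hfact : T - C x = C T.leadingCoeff * ∏ k : Fin d, (X - C (Λ k)))
    (M : Matrix (Fin d) (Fin d) ℝ)
    (hMoff : ∀ i j, i ≠ j → M i j = 1 / ((Λ i - Λ j) * (derivative T).eval (Λ j)))
    (hMdiag : ∀ i, M i i =
      (derivative (derivative T)).eval (Λ i) / (2 * (derivative T).eval (Λ i) ^ 2)) :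
    (Mᵀ * M).trace =
      -(1 / 3) * ∑ k : Fin d, polySchwarzian T (Λ k) / (derivative T).eval (Λ k) ^ 2 := by
  have hc : T.leadingCoeff ≠ 0 := by
    rw [leadingCoeff_ne_zero]
    rintro rfl
    simp at hdeg
    omega
  rw [Matrix.trace, Finset.mul_sum]
  refine Finset.sum_congr rfl fun j _ => ?_
  obtain ⟨hne, hsum⟩ := sum_inv_sq_sub_root T x T.leadingCoeff (Λ j) hc Λ (Finset.univ.erase j)
    (fun k hk => sub_ne_zero.mpr fun h => Finset.ne_of_mem_erase hk (hinj h).symm)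
    (by rw [hfact, Finset.mul_prod_erase _ (fun k => X - C (Λ k)) (Finset.mem_univ j)])
  have hoff : ∑ i ∈ Finset.univ.erase j, M i j * M i j =
      (∑ i ∈ Finset.univ.erase j, (Λ j - Λ i)⁻¹ ^ 2) / (derivative T).eval (Λ j) ^ 2 := by
    rw [Finset.sum_div]
    refine Finset.sum_congr rfl fun i hi => ?_
    rw [hMoff i j (Finset.ne_of_mem_erase hi), ← neg_sub (Λ j) (Λ i)]
    generalize Λ j - Λ i = r
    field_simp
  rw [Matrix.diag_apply, Matrix.mul_apply]
  simp only [Matrix.transpose_apply]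
  rw [← Finset.add_sum_erase _ _ (Finset.mem_univ j), hoff, hsum, hMdiag, polySchwarzian]
  field_simp
  ring
end

section
/- Let T be a polynomial with real coefficients of degree d ≥ 1 and let x ∈ ℝ be such that the polynomial T − x has d distinct real roots λ₁, …, λ_d. Let Λ = diag(λ₁, …, λ_d), let u ∈ ℝ^d have u_k = T'(λ_k) and v ∈ ℝ^d have v_k = 1/T'(λ_k). Then the d × d matrix D with entries D_{ij} = T'(λ_i)/((λ_i − λ_j)·T'(λ_j)) for i ≠ j and D_{ii} = T''(λ_i)/(2·T'(λ_i)) is the unique d × d real matrix satisfying both DΛ − ΛD = I − u·vᵀ and D·𝟙 = 0, where 𝟙 is the all-ones vector and I the identity matrix. -/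
open Polynomial Matrix

namespace Lagrange

variable {F ι : Type*} [Field F] [DecidableEq ι] {s : Finset ι} {v : ι → F} {i j : ι}

theorem basis_eq_nodalWeight_mul_nodal_erase (hi : i ∈ s) :
    Lagrange.basis s v i = C (nodalWeight s v i) * nodal (s.erase i) v := by
  rw [basis_eq_prod_sub_inv_mul_nodal_div hi, nodal_erase_eq_nodal_div hi]

theorem eval_derivative_basis_of_ne (hvs : Set.InjOn v s) (hi : i ∈ s) (hj : j ∈ s)
    (hij : i ≠ j) :
    (derivative (Lagrange.basis s v j)).eval (v i) =
      (derivative (nodal s v)).eval (v i) /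
        ((v i - v j) * (derivative (nodal s v)).eval (v j)) := by
  have hsub : v i - v j ≠ 0 := sub_ne_zero.mpr fun h => hij (hvs hi hj h)
  have hzero : (nodal (s.erase j) v).eval (v i) = 0 :=
    eval_nodal_at_node (Finset.mem_erase.mpr ⟨hij, hi⟩)
  have hnodal : (derivative (nodal s v)).eval (v i) =
      (v i - v j) * (derivative (nodal (s.erase j) v)).eval (v i) := by
    rw [nodal_eq_mul_nodal_erase hj]
    simp [derivative_mul, hzero]
  rw [basis_eq_nodalWeight_mul_nodal_erase hj, derivative_C_mul, eval_C_mul,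
    nodalWeight_eq_eval_derivative_nodal hj, hnodal, mul_div_mul_left _ _ hsub,
    div_eq_inv_mul]

theorem eval_derivative_basis_self [NeZero (2 : F)] (hi : i ∈ s) :
    (derivative (Lagrange.basis s v i)).eval (v i) =
      (derivative (derivative (nodal s v))).eval (v i) /
        (2 * (derivative (nodal s v)).eval (v i)) := by
  have hnodal : (derivative (derivative (nodal s v))).eval (v i) =
      2 * (derivative (nodal (s.erase i) v)).eval (v i) := by
    rw [nodal_eq_mul_nodal_erase hi]
    simp [derivative_mul, two_mul]
  rw [basis_eq_nodalWeight_mul_nodal_erase hi, derivative_C_mul, eval_C_mul,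
    nodalWeight_eq_eval_derivative_nodal hi, hnodal, mul_div_mul_left _ _ two_ne_zero,
    div_eq_inv_mul]

theorem sum_eval_derivative_basis (hvs : Set.InjOn v s) (hs : s.Nonempty) (a : F) :
    ∑ k ∈ s, (derivative (Lagrange.basis s v k)).eval a = 0 := by
  rw [← eval_finsetSum, ← derivative_sum, sum_basis hvs hs, derivative_one, eval_zero]

theorem eval_derivative_nodal_ne_zero (hvs : Set.InjOn v s) (hi : i ∈ s) :
    (derivative (nodal s v)).eval (v i) ≠ 0 := by
  have h := nodalWeight_ne_zero hvs hi
  rwa [nodalWeight_eq_eval_derivative_nodal hi, ne_eq, inv_eq_zero] at h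

end Lagrange

namespace Matrix

variable {n R : Type*} [Fintype n] [DecidableEq n]

theorem mul_diagonal_sub_diagonal_mul_apply [CommRing R] (A : Matrix n n R) (w : n → R)
    (i j : n) : (A * diagonal w - diagonal w * A) i j = A i j * (w j - w i) := by
  rw [sub_apply, mul_diagonal, diagonal_mul]
  ring

/-- A matrix is determined by its commutator with a diagonal matrix with distinct entries
together with its row sums. -/
theorem eq_of_commutator_diagonal_eq_of_mulVec_one_eq [CommRing R] [IsDomain R]
    {A B : Matrix n n R} {w : n → R} (hw : Function.Injective w)
    (hcomm : A * diagonal w - diagonal w * A = B * diagonal w - diagonal w * B)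
    (hsum : A *ᵥ (fun _ => 1) = B *ᵥ (fun _ => 1)) : A = B := by
  have hoff : ∀ i j, j ≠ i → A i j = B i j := fun i j hji => by
    have h := congrFun (congrFun hcomm i) j
    rw [mul_diagonal_sub_diagonal_mul_apply, mul_diagonal_sub_diagonal_mul_apply] at h
    exact mul_right_cancel₀ (sub_ne_zero.mpr (hw.ne hji)) h
  ext i j
  by_cases hji : j = i
  · subst hji
    have h := congrFun hsum j
    simp only [mulVec, dotProduct, mul_one] at h
    rw [← Finset.add_sum_erase _ _ (Finset.mem_univ j),
      ← Finset.add_sum_erase _ (B j) (Finset.mem_univ j),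
      Finset.sum_congr rfl fun k hk => hoff j k (Finset.ne_of_mem_erase hk)] at h
    exact add_right_cancel h
  · exact hoff i j hji

end Matrix

/-- If `T - x` has `d` distinct real roots, `Λm = diag(Λ)`, `u k = T'(Λ k)` and
`v k = 1/T'(Λ k)`, then the matrix `D` with `D i j = T'(Λ i)/((Λ i - Λ j)T'(Λ j))`
off the diagonal and `D i i = T''(Λ i)/(2T'(Λ i))` is the unique real `d × d` matrix
satisfying `DΛm - ΛmD = I - u vᵀ` and `D 𝟙 = 0`. -/
theorem differentiation_matrix_unique
    (d : ℕ) (hd : 1 ≤ d) (T : Polynomial ℝ) (hdeg : T.natDegree = d)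
    (x : ℝ) (Λ : Fin d → ℝ) (hinj : Function.Injective Λ)
    (hfact : T - C x = C T.leadingCoeff * ∏ k : Fin d, (X - C (Λ k)))
    (D : Matrix (Fin d) (Fin d) ℝ)
    (hDoff : ∀ i j, i ≠ j →
      D i j = (derivative T).eval (Λ i) / ((Λ i - Λ j) * (derivative T).eval (Λ j)))
    (hDdiag : ∀ i, D i i =
      (derivative (derivative T)).eval (Λ i) / (2 * (derivative T).eval (Λ i))) :
    (D * diagonal Λ - diagonal Λ * D =
        1 - Matrix.of (fun i j => (derivative T).eval (Λ i) * (1 / (derivative T).eval (Λ j))) ∧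
      D *ᵥ (fun _ => (1 : ℝ)) = 0) ∧
    ∀ D' : Matrix (Fin d) (Fin d) ℝ,
      (D' * diagonal Λ - diagonal Λ * D' =
          1 - Matrix.of (fun i j => (derivative T).eval (Λ i) * (1 / (derivative T).eval (Λ j))) ∧
        D' *ᵥ (fun _ => (1 : ℝ)) = 0) → D' = D := by
  have hvs : Set.InjOn Λ (Finset.univ : Finset (Fin d)) := hinj.injOn
  have hc : T.leadingCoeff ≠ 0 := by
    rw [Ne, leadingCoeff_eq_zero]
    rintro rfl
    simp at hdeg
    omega
  have hT : derivative T =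
      C T.leadingCoeff * derivative (Lagrange.nodal Finset.univ Λ) := by
    rw [← derivative_C_mul, Lagrange.nodal_eq, ← hfact, derivative_sub, derivative_C, sub_zero]
  have hT_ne : ∀ i, (derivative T).eval (Λ i) ≠ 0 := fun i => by
    rw [hT, eval_C_mul]
    exact mul_ne_zero hc (Lagrange.eval_derivative_nodal_ne_zero hvs (Finset.mem_univ i))
  have hD : ∀ i j, D i j = (derivative (Lagrange.basis Finset.univ Λ j)).eval (Λ i) := by
    intro i j
    by_cases hij : i = j
    · subst hij
      rw [hDdiag, Lagrange.eval_derivative_basis_self (Finset.mem_univ i), hT,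
        derivative_C_mul, eval_C_mul, eval_C_mul, mul_left_comm, mul_div_mul_left _ _ hc]
    · rw [hDoff i j hij, Lagrange.eval_derivative_basis_of_ne hvs (Finset.mem_univ i)
        (Finset.mem_univ j) hij, hT, eval_C_mul, eval_C_mul, mul_left_comm,
        mul_div_mul_left _ _ hc]
  have hcomm : D * diagonal Λ - diagonal Λ * D =
      1 - Matrix.of
        (fun i j => (derivative T).eval (Λ i) * (1 / (derivative T).eval (Λ j))) := by
    ext i j
    rw [mul_diagonal_sub_diagonal_mul_apply, Matrix.sub_apply, Matrix.of_apply]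
    by_cases hij : i = j
    · subst hij
      rw [Matrix.one_apply_eq, mul_one_div_cancel (hT_ne i), sub_self, sub_self, mul_zero]
    · have hsub : Λ i - Λ j ≠ 0 := sub_ne_zero.mpr (hinj.ne hij)
      have hj := hT_ne j
      rw [Matrix.one_apply_ne hij, hDoff i j hij]
      field_simp
      ring
  have hsum : D *ᵥ (fun _ => (1 : ℝ)) = 0 := by
    ext i
    simp only [mulVec, dotProduct, mul_one, hD, Pi.zero_apply]
    exact Lagrange.sum_eval_derivative_basis hvs ⟨⟨0, hd⟩, Finset.mem_univ _⟩ (Λ i)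
  refine ⟨⟨hcomm, hsum⟩, fun D' hD' => ?_⟩
  exact eq_of_commutator_diagonal_eq_of_mulVec_one_eq hinj (hD'.1.trans hcomm.symm)
    (hD'.2.trans hsum.symm)
end
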